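/- arXiv:0709.2607 — 2 statements merged into one kernel-verified Lean document; each statement's English description precedes it below -/
import Mathlib

section
/- Let Jac be the solution space of a Jacobi equation J'' + R(t)J = 0 on a finite-dimensional real inner product space E with each R(t) symmetric, and let Λ ⊆ Jac be a Lagrangian subspace for the canonical symplectic form. Then for every t ∈ ℝ, E decomposes orthogonally as E = Λ(t) ⊕ D(t), where Λ(t) = {J(t) : J ∈ Λ} and D(t) = {J'(t) : J ∈ Λ, J(t) = 0}; in particular D(t) = Λ(t)ᵖᵉʳᵖ. -/
open Module RealInnerProductSpace

noncomputable section

/-- `J` is a (normal) Jacobi field for the family of operators `R`, i.e. a `C²`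
solution of the Jacobi equation `J'' + R(t) J = 0`. -/
def IsJacobiField {E : Type*} [NormedAddCommGroup E] [NormedSpace ℝ E]
    (R : ℝ → E →ₗ[ℝ] E) (J : ℝ → E) : Prop :=
  ContDiff ℝ 2 J ∧ ∀ t : ℝ, deriv (deriv J) t = - R t (J t)

/-- `W(t)`: the image of an evaluation map on a space of functions at time `t`. -/
def evalAt {E : Type*} [NormedAddCommGroup E] [NormedSpace ℝ E] (t : ℝ)
    (W : Submodule ℝ (ℝ → E)) : Submodule ℝ E :=
  W.map (LinearMap.proj t : (ℝ → E) →ₗ[ℝ] E)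

theorem jacobi_unique {E : Type*} [NormedAddCommGroup E]
    [InnerProductSpace ℝ E] [FiniteDimensional ℝ E] (R : ℝ → E →ₗ[ℝ] E)
    (hRcont : Continuous fun p : ℝ × E => R p.1 p.2) (J : ℝ → E) (hJ : IsJacobiField R J)
    (t : ℝ) (h0 : J t = 0) (h1 : deriv J t = 0) : J = 0 := by
  funext s
  obtain ⟨a, b, hta, hsa⟩ : ∃ a b : ℝ, t ∈ Set.Ioo a b ∧ s ∈ Set.Ioo a b := by
    refine ⟨min t s - 1, max t s + 1, ⟨?_, ?_⟩, ⟨?_, ?_⟩⟩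
    · linarith [min_le_left t s]
    · linarith [le_max_left t s]
    · linarith [min_le_right t s]
    · linarith [le_max_right t s]
  obtain ⟨C, hC⟩ := ((isCompact_Icc (a := a) (b := b)).prod
    (isCompact_closedBall (0 : E) 1)).exists_bound_of_continuousOn hRcont.continuousOn
  have hC0 : 0 ≤ C := le_trans (norm_nonneg _)
    (hC (t, 0) ⟨⟨hta.1.le, hta.2.le⟩, by simp⟩)
  have hb : ∀ u ∈ Set.Icc a b, ∀ x : E, ‖R u x‖ ≤ C * ‖x‖ := by
    intro u hu x
    by_cases hx : x = 0
    · simp [hx]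
    have hn : 0 < ‖x‖ := norm_pos_iff.mpr hx
    have := hC (u, ‖x‖⁻¹ • x) ⟨hu, by
      simp [norm_smul, inv_mul_cancel₀ hn.ne']⟩
    simp only [map_smul, norm_smul, norm_inv, norm_norm] at this
    rwa [inv_mul_le_iff₀ hn, mul_comm] at this
  let v : ℝ → E × E → E × E := fun u p => (p.2, - R u p.1)
  have hd1 : Differentiable ℝ J := hJ.1.differentiable (by norm_num)
  have hd2 : Differentiable ℝ (deriv J) := by
    have : ContDiff ℝ (1 + 1) J := by
      have := hJ.1
      norm_num
      exact this
    exact ((contDiff_succ_iff_deriv.mp this).2.2).differentiable (by norm_num)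
  have hv : ∀ u ∈ Set.Ioo a b, LipschitzOnWith (max 1 C.toNNReal) (v u) Set.univ := by
    intro u hu
    refine (LipschitzWith.of_dist_le_mul fun p q => ?_).lipschitzOnWith
    have hp1 : ‖p.1 - q.1‖ ≤ ‖p - q‖ := norm_fst_le (p - q)
    have hp2 : ‖p.2 - q.2‖ ≤ ‖p - q‖ := norm_snd_le (p - q)
    have h1 := hb u ⟨hu.1.le, hu.2.le⟩ (p.1 - q.1)
    have e : ‖(v u p - v u q).2‖ = ‖R u (p.1 - q.1)‖ := by
      simp only [v, Prod.snd_sub, map_sub]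
      rw [← norm_neg]; congr 1; abel
    rw [dist_eq_norm, dist_eq_norm, NNReal.coe_max, Real.coe_toNNReal _ hC0, NNReal.coe_one]
    rw [Prod.norm_def, e]
    have m1 : (1:ℝ) ≤ max 1 C := le_max_left _ _
    have m2 : C ≤ max 1 C := le_max_right _ _
    refine max_le ?_ ?_
    · calc ‖p.2 - q.2‖ ≤ 1 * ‖p - q‖ := by simpa using hp2
        _ ≤ _ := by gcongr
    · calc _ ≤ C * ‖p.1 - q.1‖ := h1
        _ ≤ _ := by gcongr
  have key := ODE_solution_unique_of_mem_Ioo (v := v) (s := fun _ => Set.univ)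
    (f := fun u => (J u, deriv J u)) (g := fun _ => (0 : E × E)) hv hta
    (fun u _ => ⟨by
      have := (hd1 u).hasDerivAt.prodMk (hd2 u).hasDerivAt
      rwa [hJ.2 u] at this, trivial⟩)
    (fun u _ => ⟨by
      have := hasDerivAt_const u (0 : E × E)
      convert this using 1
      simp [v], trivial⟩) (by simp [h0, h1])
  exact congrArg Prod.fst (key hsa)

/-- For a Lagrangian subspace `Λ` of the space of Jacobi fields, at each time `t` the space
`E` decomposes orthogonally as `E = Λ(t) ⊕ D(t)`, where `Λ(t) = {J(t) : J ∈ Λ}` and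
`D(t) = {J'(t) : J ∈ Λ, J(t) = 0}`; in particular `D(t) = Λ(t)ᗮ`. -/
theorem lagrangian_orthogonal_decomposition {E : Type*} [NormedAddCommGroup E]
    [InnerProductSpace ℝ E] [FiniteDimensional ℝ E] (R : ℝ → E →ₗ[ℝ] E)
    (hRcont : Continuous fun p : ℝ × E => R p.1 p.2)
    (hRsym : ∀ t : ℝ, (R t).IsSymmetric)
    (Λ : Submodule ℝ (ℝ → E)) (hsol : ∀ J ∈ Λ, IsJacobiField R J)
    (hiso : ∀ J₁ ∈ Λ, ∀ J₂ ∈ Λ, ∀ t : ℝ,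
      (⟪deriv J₁ t, J₂ t⟫ : ℝ) - ⟪J₁ t, deriv J₂ t⟫ = 0)
    (hdim : finrank ℝ Λ = finrank ℝ E) :
    ∀ t : ℝ, ∃ D : Submodule ℝ E,
      (D : Set E) = {x : E | ∃ J ∈ Λ, J t = 0 ∧ deriv J t = x} ∧
      D = (evalAt t Λ)ᗮ ∧ IsCompl (evalAt t Λ) D := by
  intro t
  have hdiff : ∀ J ∈ Λ, DifferentiableAt ℝ J t := fun J hJ =>
    ((hsol J hJ).1.differentiable (by norm_num)) t
  let ev : Λ →ₗ[ℝ] E := (LinearMap.proj t : (ℝ → E) →ₗ[ℝ] E).comp Λ.subtype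
  let d : Λ →ₗ[ℝ] E :=
    { toFun := fun J => deriv J.1 t
      map_add' := fun J K => deriv_add (hdiff _ J.2) (hdiff _ K.2)
      map_smul' := fun c J => deriv_const_smul c (hdiff _ J.2) }
  have hinj : ∀ J : Λ, ev J = 0 → d J = 0 → J = 0 := fun J h0 h1 =>
    Subtype.ext (jacobi_unique R hRcont J.1 (hsol _ J.2) t h0 h1)
  have hfin : FiniteDimensional ℝ Λ := by
    refine FiniteDimensional.of_injective (ev.prod d) ?_
    rw [← LinearMap.ker_eq_bot, LinearMap.ker_eq_bot']
    intro J hJ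
    exact hinj J (congrArg Prod.fst hJ) (congrArg Prod.snd hJ)
  let dK : LinearMap.ker ev →ₗ[ℝ] E := d.comp (LinearMap.ker ev).subtype
  have hdK : Function.Injective dK := by
    intro J K hJK
    have e0 : ev (J.1 - K.1) = 0 := by
      rw [map_sub, LinearMap.mem_ker.mp J.2, LinearMap.mem_ker.mp K.2, sub_zero]
    have e1 : d (J.1 - K.1) = 0 := by
      rw [map_sub, sub_eq_zero]
      exact hJK
    exact Subtype.ext (sub_eq_zero.mp (hinj _ e0 e1))
  have hev : LinearMap.range ev = evalAt t Λ := by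
    simp only [ev, evalAt, LinearMap.range_comp, Submodule.range_subtype]
  have hD : LinearMap.range dK = (evalAt t Λ)ᗮ := by
    refine Submodule.eq_of_le_of_finrank_eq ?_ ?_
    · rintro _ ⟨J, rfl⟩
      rw [Submodule.mem_orthogonal]
      rintro _ ⟨K, hK, rfl⟩
      have h := hiso K hK J.1.1 J.1.2 t
      have h0 : J.1.1 t = 0 := J.2
      rw [h0, inner_zero_right, zero_sub, neg_eq_zero] at h
      exact h
    · have h1 := LinearMap.finrank_range_of_inj hdK
      have h2 := LinearMap.finrank_range_add_finrank_ker ev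
      have h3 := Submodule.finrank_add_finrank_orthogonal (evalAt t Λ)
      rw [hev] at h2
      omega
  refine ⟨LinearMap.range dK, ?_, hD, ?_⟩
  · ext x
    constructor
    · rintro ⟨J, rfl⟩
      exact ⟨J.1.1, J.1.2, J.2, rfl⟩
    · rintro ⟨J, hJ, h0, rfl⟩
      exact ⟨⟨⟨J, hJ⟩, h0⟩, rfl⟩
  · rw [hD]
    exact Submodule.isCompl_orthogonal _
end
end

section
/- Let Jac be the solution space of a Jacobi equation J'' + R(t)J = 0 on a finite-dimensional real inner product space E with each R(t) symmetric, and let Λ be a Lagrangian subspace of Jac. On any compact interval [a,b], the set of Λ-focal points in [a,b] is finite, so the index ind_Λ([a,b]) = Σ_{t ∈ [a,b]} (dim Λ − dim Λ(t)) is a well-defined natural number. -/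
open Module RealInnerProductSpace

noncomputable section

theorem jacobi_unique_aux {E : Type*} [NormedAddCommGroup E]
    [InnerProductSpace ℝ E] [FiniteDimensional ℝ E] (R : ℝ → E →ₗ[ℝ] E)
    (hRcont : Continuous fun p : ℝ × E => R p.1 p.2) (J : ℝ → E)
    (hJ : IsJacobiField R J) (t₀ : ℝ) (h0 : J t₀ = 0) (h1 : deriv J t₀ = 0) : J = 0 := by
  obtain ⟨hC, hE⟩ := hJ
  let A : ℝ → E →L[ℝ] E := fun t => LinearMap.toContinuousLinearMap (R t)
  have hA : Continuous A := by
    rw [continuous_clm_apply]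
    intro y
    exact hRcont.comp (continuous_id.prodMk continuous_const)
  let V : ℝ → (E × E) →L[ℝ] (E × E) := fun t =>
    (ContinuousLinearMap.snd ℝ E E).prod (-(A t ∘L ContinuousLinearMap.fst ℝ E E))
  have hV : Continuous V := by
    rw [continuous_clm_apply]
    intro y
    refine continuous_const.prodMk ?_
    exact ((hRcont.comp (continuous_id.prodMk continuous_const)).neg :
      Continuous fun t => -(R t y.1))
  have hd1 : Differentiable ℝ J := hC.differentiable (by norm_num)
  have hd2 : Differentiable ℝ (deriv J) := by
    have : ContDiff ℝ (1+1) J := by simpa [one_add_one_eq_two] using hC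
    exact (contDiff_succ_iff_deriv.1 this).2.2.differentiable (by norm_num)
  funext t
  set l := min t t₀ - 1
  set u := max t t₀ + 1
  have ht : t ∈ Set.Ioo l u := ⟨by have := min_le_left t t₀; simp only [l]; linarith,
    by have := le_max_left t t₀; simp only [u]; linarith⟩
  have ht₀ : t₀ ∈ Set.Ioo l u := ⟨by have := min_le_right t t₀; simp only [l]; linarith,
    by have := le_max_right t t₀; simp only [u]; linarith⟩
  obtain ⟨K, hK⟩ := (isCompact_Icc (a := l) (b := u)).exists_bound_of_continuousOn
    (f := V) hV.continuousOn
  have key := ODE_solution_unique_of_mem_Ioo (v := fun t x => V t x) (s := fun _ => Set.univ)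
    (K := K.toNNReal) (f := fun t => (J t, deriv J t)) (g := fun _ => (0 : E × E))
    (a := l) (b := u) (t₀ := t₀) ?_ ht₀ ?_ ?_ ?_
  · have := key ht
    exact congrArg Prod.fst this
  · intro s hs
    refine LipschitzWith.lipschitzOnWith ?_
    refine (V s).lipschitz.weaken ?_
    rw [← NNReal.coe_le_coe]
    exact (hK s (Set.Ioo_subset_Icc_self hs)).trans (Real.le_coe_toNNReal K)
  · intro s _
    refine ⟨?_, Set.mem_univ _⟩
    have e2 := (hd2 s).hasDerivAt
    rw [hE s] at e2
    exact (hd1 s).hasDerivAt.prodMk e2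
  · intro s _
    refine ⟨?_, Set.mem_univ _⟩
    rw [map_zero]
    exact hasDerivAt_const _ _
  · simp [h0, h1]

theorem focal_set_finite_aux {E : Type*} [NormedAddCommGroup E]
    [InnerProductSpace ℝ E] [FiniteDimensional ℝ E] (R : ℝ → E →ₗ[ℝ] E)
    (hRcont : Continuous fun p : ℝ × E => R p.1 p.2)
    (Λ : Submodule ℝ (ℝ → E)) (hsol : ∀ J ∈ Λ, IsJacobiField R J)
    (hiso : ∀ J₁ ∈ Λ, ∀ J₂ ∈ Λ, ∀ t : ℝ,
      (⟪deriv J₁ t, J₂ t⟫ : ℝ) - ⟪J₁ t, deriv J₂ t⟫ = 0)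
    (a b : ℝ) :
    {t ∈ Set.Icc a b | finrank ℝ (evalAt t Λ) < finrank ℝ Λ}.Finite := by
  classical
  rcases Nat.eq_zero_or_pos (finrank ℝ Λ) with h0 | hpos
  · simp [h0]
  haveI : FiniteDimensional ℝ Λ := FiniteDimensional.of_finrank_pos hpos
  let B := finBasis ℝ Λ
  let J : (Fin (finrank ℝ Λ) → ℝ) → ℝ → E := fun c => ((B.equivFun.symm c : Λ) : ℝ → E)
  have hmem : ∀ c, J c ∈ Λ := fun c => (B.equivFun.symm c).2
  have hJ : ∀ c, J c = fun t => ∑ i, c i • (B i : ℝ → E) t := by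
    intro c
    funext t
    simp [J, Basis.equivFun_symm_apply]
  have hdiff : ∀ i, Differentiable ℝ (B i : ℝ → E) := fun i =>
    (hsol _ (B i).2).1.differentiable (by norm_num)
  have hdc : ∀ i, Continuous (deriv (B i : ℝ → E)) := fun i =>
    (hsol _ (B i).2).1.continuous_deriv (by norm_num)
  have hdJ : ∀ c t, deriv (J c) t = ∑ i, c i • deriv (B i : ℝ → E) t := by
    intro c t
    rw [hJ]
    exact (HasDerivAt.fun_sum fun i _ => ((hdiff i t).hasDerivAt.const_smul (c i))).deriv
  have hJd : ∀ c, Differentiable ℝ (J c) := fun c =>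
    (hsol _ (hmem c)).1.differentiable (by norm_num)
  have hF : Continuous fun p : (Fin (finrank ℝ Λ) → ℝ) × ℝ => J p.1 p.2 := by
    simp only [hJ]
    refine continuous_finset_sum _ fun i _ => ?_
    exact ((continuous_apply i).comp continuous_fst).smul
      ((hdiff i).continuous.comp continuous_snd)
  have hF' : Continuous fun p : (Fin (finrank ℝ Λ) → ℝ) × ℝ => deriv (J p.1) p.2 := by
    simp only [hdJ]
    refine continuous_finset_sum _ fun i _ => ?_
    exact ((continuous_apply i).comp continuous_fst).smul ((hdc i).comp continuous_snd)
  have hfoc : ∀ t, finrank ℝ (evalAt t Λ) < finrank ℝ Λ →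
      ∃ c ∈ Metric.sphere (0 : Fin (finrank ℝ Λ) → ℝ) 1, J c t = 0 := by
    intro t ht
    have hni : ¬ Function.Injective
        ((LinearMap.proj t : (ℝ → E) →ₗ[ℝ] E) ∘ₗ Λ.subtype) := by
      intro hi
      have := LinearMap.finrank_range_of_inj hi
      rw [LinearMap.range_comp, Submodule.range_subtype] at this
      exact absurd this ht.ne
    rw [injective_iff_map_eq_zero] at hni
    push Not at hni
    obtain ⟨x, hx, hx0⟩ := hni
    have hc : B.equivFun x ≠ 0 := by simpa using hx0
    refine ⟨‖B.equivFun x‖⁻¹ • B.equivFun x, ?_, ?_⟩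
    · rw [mem_sphere_zero_iff_norm, norm_smul, norm_inv, norm_norm,
        inv_mul_cancel₀ (norm_ne_zero_iff.2 hc)]
    · have hx' : (x : ℝ → E) t = 0 := hx
      simp only [J, map_smul, LinearEquiv.symm_apply_apply]
      simp [hx']
  by_contra hinf
  obtain ⟨t₀, -, hacc⟩ := Set.Infinite.exists_accPt_of_subset_isCompact hinf
    isCompact_Icc (Set.sep_subset _ _)
  rw [accPt_iff_frequently_nhdsNE] at hacc
  obtain ⟨τ, hτ, hτS⟩ := Filter.exists_seq_forall_of_frequently hacc
  choose c hcS hc0 using fun k => hfoc (τ k) (hτS k).2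
  obtain ⟨c₀, hc₀, φ, hφ, hlim⟩ := (isCompact_sphere _ _).tendsto_subseq hcS
  have hτφ : Filter.Tendsto (τ ∘ φ) Filter.atTop (nhdsWithin t₀ {t₀}ᶜ) :=
    hτ.comp hφ.tendsto_atTop
  have hτn : Filter.Tendsto (τ ∘ φ) Filter.atTop (nhds t₀) :=
    hτφ.mono_right nhdsWithin_le_nhds
  have hpair := hlim.prodMk_nhds hτn
  have hz : J c₀ t₀ = 0 := by
    have h1 := (hF.tendsto (c₀, t₀)).comp hpair
    refine tendsto_nhds_unique h1 ?_
    have : (fun p : (Fin (finrank ℝ Λ) → ℝ) × ℝ => J p.1 p.2) ∘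
      (fun k => ((c ∘ φ) k, (τ ∘ φ) k)) = fun _ => 0 := by
      funext k; exact hc0 (φ k)
    rw [this]
    exact tendsto_const_nhds
  have h2 := (hF'.tendsto (c₀, t₀)).comp hpair
  have h3 := (hasDerivAt_iff_tendsto_slope.1 (hJd c₀ t₀).hasDerivAt).comp hτφ
  have h4 := h2.inner (𝕜 := ℝ) h3
  have h5 : (⟪deriv (J c₀) t₀, deriv (J c₀) t₀⟫ : ℝ) = 0 := by
    refine tendsto_nhds_unique h4 ?_
    refine tendsto_const_nhds.congr fun k => ?_
    have := hiso _ (hmem (c (φ k))) _ (hmem c₀) (τ (φ k))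
    rw [hc0, inner_zero_left, sub_zero] at this
    simp [slope, hz, inner_smul_right, this]
  have h6 := jacobi_unique_aux R hRcont (J c₀) (hsol _ (hmem c₀)) t₀ hz (inner_self_eq_zero.1 h5)
  have h7 : c₀ = 0 := by
    have : B.equivFun.symm c₀ = 0 := Subtype.ext h6
    exact (LinearEquiv.map_eq_zero_iff _).1 this
  rw [h7] at hc₀
  simp at hc₀

/-- For a Lagrangian subspace `Λ` of Jacobi fields, the set of `Λ`-focal points in a compact
interval `[a,b]` is finite, so the index `ind_Λ([a,b]) = Σ_{t ∈ [a,b]} (dim Λ − dim Λ(t))`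
is a well-defined natural number (here expressed as a finite sum `∑ᶠ`). -/
theorem focal_points_finite_on_compact {E : Type*} [NormedAddCommGroup E]
    [InnerProductSpace ℝ E] [FiniteDimensional ℝ E] (R : ℝ → E →ₗ[ℝ] E)
    (hRcont : Continuous fun p : ℝ × E => R p.1 p.2)
    (hRsym : ∀ t : ℝ, (R t).IsSymmetric)
    (Λ : Submodule ℝ (ℝ → E)) (hsol : ∀ J ∈ Λ, IsJacobiField R J)
    (hiso : ∀ J₁ ∈ Λ, ∀ J₂ ∈ Λ, ∀ t : ℝ,
      (⟪deriv J₁ t, J₂ t⟫ : ℝ) - ⟪J₁ t, deriv J₂ t⟫ = 0)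
    (hdim : finrank ℝ Λ = finrank ℝ E) (a b : ℝ) :
    {t ∈ Set.Icc a b | finrank ℝ (evalAt t Λ) < finrank ℝ Λ}.Finite ∧
    (Function.support ((Set.Icc a b).indicator
        fun t => finrank ℝ Λ - finrank ℝ (evalAt t Λ))).Finite := by
  have h := focal_set_finite_aux R hRcont Λ hsol hiso a b
  refine ⟨h, h.subset fun t ht => ?_⟩
  rw [Function.mem_support] at ht
  have hm : t ∈ Set.Icc a b := by
    by_contra hn
    exact ht (Set.indicator_of_notMem hn _)
  rw [Set.indicator_of_mem hm] at ht
  exact ⟨hm, by omega⟩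
end
end
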